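/- arXiv:1608.01962 — 3 statements merged into one kernel-verified Lean document; each statement's English description precedes it below -/
import Mathlib

section
/- Let (Γ_q, i_q) be a Bourgain–Delbaen system on Γ with constant C = sup_q ‖i_q‖, and let X be the associated Bourgain–Delbaen space. Then the family (e_γ^*)_{γ∈Γ} of evaluation functionals on X is C-equivalent to the unit vector basis of ℓ₁(Γ): for every finitely supported family of real scalars (a_γ)_{γ∈Γ} one has (1/C)·Σ_γ |a_γ| ≤ ‖Σ_γ a_γ e_γ^*‖_{X^*} ≤ Σ_γ |a_γ|. -/
noncomputable section
open scoped ENNReal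

/-- `ℓ∞(Γ)`. -/
abbrev Linfty (Γ : Type) := lp (fun _ : Γ => ℝ) ∞

/-- The evaluation functional `f ↦ f γ` on `ℓ∞(Γ)`. -/
def evalLinfty {Γ : Type} (γ : Γ) : Linfty Γ →L[ℝ] ℝ :=
  LinearMap.mkContinuous
    { toFun := fun f => f γ
      map_add' := fun f g => by simp [lp.coeFn_add]
      map_smul' := fun c f => by simp [lp.coeFn_smul] }
    1 (fun f => by
      rw [one_mul]
      exact lp.norm_apply_le_norm ENNReal.top_ne_zero f γ)

/-- The restriction operator `r_s : ℓ∞(Γ) → ℓ∞(s)` for a finite subset `s` of `Γ`;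
the target carries the sup norm. -/
def restrFin {Γ : Type} (s : Finset Γ) : Linfty Γ →L[ℝ] (↥s → ℝ) :=
  LinearMap.mkContinuous
    { toFun := fun f γ => f (γ : Γ)
      map_add' := fun f g => by funext γ; simp [lp.coeFn_add]
      map_smul' := fun c f => by funext γ; simp [lp.coeFn_smul] }
    1 (fun f => by
      rw [one_mul]
      refine (pi_norm_le_iff_of_nonneg (norm_nonneg f)).mpr ?_
      intro γ
      exact lp.norm_apply_le_norm ENNReal.top_ne_zero f (γ : Γ))

/-- A Bourgain–Delbaen system on a set `Γ`: a strictly increasing sequence of finite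
subsets of `Γ` with union `Γ`, together with a uniformly bounded compatible sequence of
extension operators.  We use the convention `Gam 0 = ∅`, so that for `q ≥ 1` the set
`Gam q` is the set `Γ_q` of the paper (all of them nonempty, by strict monotonicity). -/
structure BDSystem (Γ : Type) where
  Gam : ℕ → Finset Γ
  Gam_zero : Gam 0 = ∅
  mono : StrictMono Gam
  exhaustive : ∀ γ : Γ, ∃ q, γ ∈ Gam q
  i : ∀ q : ℕ, (↥(Gam q) → ℝ) →L[ℝ] Linfty Γ
  isExtension : ∀ (q : ℕ) (x : ↥(Gam q) → ℝ) (γ : ↥(Gam q)), (i q x) (γ : Γ) = x γ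
  compatible : ∀ p q : ℕ, p < q → ∀ x : ↥(Gam p) → ℝ,
      i p x = i q (fun γ : ↥(Gam q) => (i p x) (γ : Γ))
  normBound : ℝ
  norm_i_le : ∀ q, ‖i q‖ ≤ normBound

namespace BDSystem

variable {Γ : Type} (S : BDSystem Γ)

/-- The constant `C = sup_q ‖i_q‖` of the system. -/
def const : ℝ := ⨆ q, ‖S.i q‖

/-- The rank of `γ`: the unique `q` with `γ ∈ Δ_q = Γ_q ∖ Γ_{q-1}`, i.e. the least `q`
with `γ ∈ Γ_q`. -/
def rank (γ : Γ) : ℕ := @Nat.find _ (Classical.decPred _) (S.exhaustive γ)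

/-- The vector `d_γ = i_q (e_γ) ∈ ℓ∞(Γ)`, where `q = rank γ`. -/
def dvec (γ : Γ) : Linfty Γ :=
  S.i (S.rank γ) (fun η => @ite _ ((η : Γ) = γ) (Classical.dec _) 1 0)

/-- The Bourgain–Delbaen space `X`, the closed linear span of `{d_γ : γ ∈ Γ}`,
as a closed submodule of `ℓ∞(Γ)`. -/
def X : Submodule ℝ (Linfty Γ) :=
  (Submodule.span ℝ (Set.range S.dvec)).topologicalClosure

theorem dvec_mem_X (γ : Γ) : S.dvec γ ∈ S.X :=
  (Submodule.span ℝ (Set.range S.dvec)).le_topologicalClosure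
    (Submodule.subset_span (Set.mem_range_self γ))

/-- `d_γ` as an element of the space `X`. -/
def dX (γ : Γ) : ↥S.X := ⟨S.dvec γ, S.dvec_mem_X γ⟩

/-- The evaluation functional `e_γ^* ∈ X^*`. -/
def evalX (γ : Γ) : StrongDual ℝ ↥S.X :=
  (evalLinfty γ).comp S.X.subtypeL

/-- The cumulative projection `P_{[1,q]}`: the restriction to `X` of `i_q ∘ r_q`
(with values in `ℓ∞(Γ)`).  Note that `P_{[1,0]} = 0`, since `Gam 0 = ∅`. -/
def P (q : ℕ) : ↥S.X →L[ℝ] Linfty Γ :=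
  ((S.i q).comp (restrFin (S.Gam q))).comp S.X.subtypeL

/-- `P_{[1,q]}` for `q ∈ ℕ ∪ {∞}`, where `P_{[1,∞]}` is the inclusion of `X` into `ℓ∞(Γ)`. -/
def Pcum : ℕ∞ → (↥S.X →L[ℝ] Linfty Γ)
  | (q : ℕ) => S.P q
  | ⊤ => S.X.subtypeL

/-- The projection `P_E` associated to the interval `E = (p, q]` of `ℕ` (`q = ⊤` allowed). -/
def PE (p : ℕ) (q : ℕ∞) : ↥S.X →L[ℝ] Linfty Γ := S.Pcum q - S.P p

/-- The functional `d_γ^* = e_γ^* ∘ P_{(rank γ − 1, rank γ]}`, biorthogonal to `d_γ`. -/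
def dstar (γ : Γ) : StrongDual ℝ ↥S.X :=
  (evalLinfty γ).comp (S.PE (S.rank γ - 1) (S.rank γ))

/-- The functional `c_γ^* = e_γ^* − d_γ^*`. -/
def cstar (γ : Γ) : StrongDual ℝ ↥S.X := S.evalX γ - S.dstar γ

/-- A subset `Γ'` of `Γ` is self-determined if it is infinite and for every `γ ∈ Γ'` the
functional `d_γ^*` lies in the linear span of `{e_η^* : η ∈ Γ'}` in `X^*`. -/
def SelfDetermined (Γ' : Set Γ) : Prop :=
  Γ'.Infinite ∧ ∀ γ ∈ Γ', S.dstar γ ∈ Submodule.span ℝ (S.evalX '' Γ')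

end BDSystem

theorem BDSystem.dvec_eq_of_rank {Γ : Type} (S : BDSystem Γ) (q : ℕ) (γ : Γ) (h : S.rank γ = q) :
    S.i q (fun η => @ite _ ((η : Γ) = γ) (Classical.dec _) 1 0) = S.dvec γ := by
  subst h
  rfl

theorem BDSystem.rank_eq {Γ : Type} (S : BDSystem Γ) (q : ℕ) (γ : Γ) (h : γ ∈ S.Gam (q + 1))
    (h' : γ ∉ S.Gam q) : S.rank γ = q + 1 := by
  unfold BDSystem.rank
  refine (@Nat.find_eq_iff _ _ (Classical.decPred _) _).mpr ⟨h, fun n hn hmem => h' ?_⟩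
  exact S.mono.monotone (Nat.lt_succ_iff.mp hn) hmem

/-- The image of every extension operator is contained in `X`. -/
theorem BDSystem.i_mem_X {Γ : Type} (S : BDSystem Γ) (q : ℕ) :
    ∀ x : ↥(S.Gam q) → ℝ, S.i q x ∈ S.X := by
  classical
  induction q with
  | zero =>
    intro x
    have hx : x = 0 := by
      funext γ
      have h0 : ∀ η : Γ, η ∉ S.Gam 0 := fun η => by rw [S.Gam_zero]; simp
      exact absurd γ.2 (h0 γ)
    rw [hx, map_zero]
    exact S.X.zero_mem
  | succ q ih =>
    intro x
    have hsub : S.Gam q ⊆ S.Gam (q + 1) := S.mono.monotone (Nat.le_succ q)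
    let z : ↥(S.Gam q) → ℝ := fun γ => x ⟨γ, hsub γ.2⟩
    let w : ↥(S.Gam (q + 1)) → ℝ := fun γ => (S.i q z) (γ : Γ)
    have hw : S.i q z = S.i (q + 1) w := S.compatible q (q + 1) (Nat.lt_succ_self q) z
    let e : ↥(S.Gam (q + 1)) → ↥(S.Gam (q + 1)) → ℝ :=
      fun γ η => @ite _ ((η : Γ) = (γ : Γ)) (Classical.dec _) 1 0
    have hy : x = w + ∑ γ, (x γ - w γ) • e γ := by
      funext η
      simp only [Pi.add_apply, Finset.sum_apply, Pi.smul_apply, smul_eq_mul]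
      rw [Finset.sum_eq_single η]
      · simp [e]
      · intro b _ hb
        simp [e, hb.symm]
      · intro h
        exact absurd (Finset.mem_univ _) h
    rw [hy, map_add, ← hw, map_sum]
    refine S.X.add_mem (ih z) (S.X.sum_mem fun γ _ => ?_)
    rw [map_smul]
    by_cases hγ : (γ : Γ) ∈ S.Gam q
    · have : w γ = x γ := S.isExtension q z ⟨γ, hγ⟩
      rw [this, sub_self, zero_smul]
      exact S.X.zero_mem
    · refine S.X.smul_mem _ ?_
      have h2 : S.i (q + 1) (e γ) = S.dvec γ :=
        S.dvec_eq_of_rank (q + 1) γ (S.rank_eq q γ γ.2 hγ)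
      rw [h2]
      exact S.dvec_mem_X γ

theorem BDSystem.exists_support_subset {Γ : Type} (S : BDSystem Γ) (s : Finset Γ) :
    ∃ q, s ⊆ S.Gam q := by
  classical
  induction s using Finset.induction_on with
  | empty => exact ⟨0, by simp⟩
  | insert γ s _ ih =>
    obtain ⟨q, hq⟩ := ih
    obtain ⟨p, hp⟩ := S.exhaustive γ
    refine ⟨max p q, Finset.insert_subset ?_ ?_⟩
    · exact S.mono.monotone (le_max_left p q) hp
    · exact hq.trans (S.mono.monotone (le_max_right p q))

/-- The family `(e_γ^*)_{γ ∈ Γ}` of evaluation functionals on a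
Bourgain–Delbaen space is `C`-equivalent to the unit vector basis of `ℓ₁(Γ)`, where
`C = sup_q ‖i_q‖`. -/
theorem evalX_equiv_ell_one_basis {Γ : Type} (S : BDSystem Γ) (a : Γ →₀ ℝ) :
    (1 / S.const) * (∑ γ ∈ a.support, |a γ|) ≤ ‖∑ γ ∈ a.support, a γ • S.evalX γ‖ ∧
      ‖∑ γ ∈ a.support, a γ • S.evalX γ‖ ≤ ∑ γ ∈ a.support, |a γ| := by
  constructor
  · obtain ⟨q, hq⟩ := S.exists_support_subset a.support
    let x : ↥(S.Gam q) → ℝ := fun γ => SignType.sign (a γ)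
    have hx : ‖x‖ ≤ 1 := by
      refine (pi_norm_le_iff_of_nonneg zero_le_one).mpr fun γ => ?_
      rcases lt_trichotomy (a γ) 0 with h | h | h <;> simp [x, h]
    have hbdd : BddAbove (Set.range fun q => ‖S.i q‖) :=
      ⟨S.normBound, by rintro _ ⟨p, rfl⟩; exact S.norm_i_le p⟩
    have hC : ‖S.i q‖ ≤ S.const := le_ciSup hbdd q
    have hC0 : 0 ≤ S.const := (norm_nonneg _).trans hC
    let v : ↥S.X := ⟨S.i q x, S.i_mem_X q x⟩
    have hv : ‖v‖ ≤ S.const := by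
      calc ‖v‖ = ‖S.i q x‖ := rfl
        _ ≤ ‖S.i q‖ * ‖x‖ := (S.i q).le_opNorm x
        _ ≤ ‖S.i q‖ * 1 := mul_le_mul_of_nonneg_left hx (norm_nonneg _)
        _ ≤ S.const := by rw [mul_one]; exact hC
    have hval : (∑ γ ∈ a.support, a γ • S.evalX γ) v = ∑ γ ∈ a.support, |a γ| := by
      rw [_root_.sum_apply]
      refine Finset.sum_congr rfl fun γ hγ => ?_
      have h1 : S.evalX γ v = SignType.sign (a γ) := S.isExtension q x ⟨γ, hq hγ⟩
      rw [_root_.smul_apply, h1, smul_eq_mul, self_mul_sign]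
    have hle : ∑ γ ∈ a.support, |a γ| ≤ ‖∑ γ ∈ a.support, a γ • S.evalX γ‖ * S.const := by
      rw [← hval]
      refine (le_abs_self _).trans ?_
      exact ((∑ γ ∈ a.support, a γ • S.evalX γ).le_opNorm v).trans
        (mul_le_mul_of_nonneg_left hv (ContinuousLinearMap.opNorm_nonneg _))
    rcases hC0.eq_or_lt with h | h
    · rw [← h, div_zero, zero_mul]
      exact ContinuousLinearMap.opNorm_nonneg _
    · rw [one_div, inv_mul_le_iff₀ h, mul_comm]
      exact hle
  · refine ContinuousLinearMap.opNorm_le_bound _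
      (Finset.sum_nonneg fun γ _ => abs_nonneg _) fun v => ?_
    rw [_root_.sum_apply, Finset.sum_mul]
    refine (norm_sum_le _ _).trans (Finset.sum_le_sum fun γ _ => ?_)
    rw [_root_.smul_apply, norm_smul, Real.norm_eq_abs]
    refine mul_le_mul_of_nonneg_left ?_ (abs_nonneg _)
    exact lp.norm_apply_le_norm ENNReal.top_ne_zero (v : Linfty Γ) γ
end
end

section
/- Let (Γ_q, i_q) be a Bourgain–Delbaen system on Γ with associated Bourgain–Delbaen space X, let Γ' be an infinite subset of Γ, set Γ'_q = Γ' ∩ Γ_q for each q and q₀ = min{q : Γ'_q ≠ ∅}. Then the following assertions are equivalent: (a) Γ' is self-determined; (b) for all q ≥ q₀, the linear span of {d_γ^* : γ ∈ Γ'_q} equals the linear span of {e_γ^* : γ ∈ Γ'_q} in X^*; (c) the linear span of {d_γ^* : γ ∈ Γ'_{q₀}} equals the linear span of {e_γ^* : γ ∈ Γ'_{q₀}}, and for every q ≥ q₀ and every γ ∈ Γ' ∩ Δ_{q+1}, c_γ^* lies in the linear span of {e_η^* ∘ P_E : η ∈ Γ'_q, E an interval of ℕ}; (d) for all γ ∈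 Γ ∖ Γ' and η ∈ Γ', e_η^*(d_γ) = 0; (e) for all γ ∈ Γ ∖ Γ' and η ∈ Γ', c_η^*(d_γ) = 0. -/
noncomputable section
open scoped ENNReal

namespace BDSystem

variable {Γ : Type} (S : BDSystem Γ)

theorem mem_Gam_rank (γ : Γ) : γ ∈ S.Gam (S.rank γ) :=
  @Nat.find_spec _ (Classical.decPred _) (S.exhaustive γ)

theorem mem_Gam_iff (γ : Γ) (q : ℕ) : γ ∈ S.Gam q ↔ S.rank γ ≤ q := by
  constructor
  · intro h
    exact @Nat.find_min' _ (Classical.decPred _) (S.exhaustive γ) _ h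
  · intro h
    exact S.mono.monotone h (S.mem_Gam_rank γ)

theorem rank_pos (γ : Γ) : 0 < S.rank γ := by
  rw [Nat.pos_iff_ne_zero]
  intro h
  have := S.mem_Gam_rank γ
  rw [h, S.Gam_zero] at this
  simp at this

open Classical in
theorem dvec_apply {ζ η : Γ} (h : S.rank ζ ≤ S.rank η) :
    S.dvec η ζ = if ζ = η then 1 else 0 := by
  have := S.isExtension (S.rank η)
    (fun ξ => @ite _ ((ξ : Γ) = η) (Classical.dec _) 1 0) ⟨ζ, (S.mem_Gam_iff _ _).2 h⟩
  unfold dvec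
  rw [this]

theorem evalX_dX (ζ η : Γ) : S.evalX ζ (S.dX η) = S.dvec η ζ := rfl

theorem P_dX_of_le {η : Γ} {q : ℕ} (h : S.rank η ≤ q) : S.P q (S.dX η) = S.dvec η := by
  rcases h.lt_or_eq with h | h
  · exact (S.compatible _ _ h _).symm
  · subst h
    change S.i (S.rank η) _ = S.i (S.rank η) _
    congr 1
    funext ζ
    exact S.isExtension _ _ ζ

theorem P_dX_of_lt {η : Γ} {q : ℕ} (h : q < S.rank η) : S.P q (S.dX η) = 0 := by
  change S.i q (fun ζ => S.dvec η ζ) = 0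
  have : (fun ζ : S.Gam q => S.dvec η (ζ : Γ)) = 0 := by
    funext ζ
    have hz := (S.mem_Gam_iff ζ q).1 ζ.2
    rw [S.dvec_apply (by omega), if_neg]
    · rfl
    · intro e
      rw [e] at hz
      omega
  rw [this, map_zero]

theorem PE_coe_apply (p q : ℕ) (x : S.X) : S.PE p (q : ℕ∞) x = S.P q x - S.P p x := rfl

theorem PE_top_apply (p : ℕ) (x : S.X) : S.PE p ⊤ x = (x : Linfty Γ) - S.P p x := rfl

theorem evalLinfty_apply (γ : Γ) (f : Linfty Γ) : evalLinfty γ f = f γ := rfl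

open Classical in
theorem dstar_dX (γ η : Γ) : S.dstar γ (S.dX η) = if γ = η then 1 else 0 := by
  have hp := S.rank_pos γ
  change evalLinfty γ (S.PE (S.rank γ - 1) (S.rank γ : ℕ∞) (S.dX η)) = _
  rw [PE_coe_apply, map_sub]
  rcases lt_trichotomy (S.rank η) (S.rank γ) with h | h | h
  · rw [S.P_dX_of_le h.le, S.P_dX_of_le (by omega), sub_self, if_neg]
    rintro rfl
    omega
  · rw [S.P_dX_of_le h.le, S.P_dX_of_lt (by omega), map_zero, sub_zero, evalLinfty_apply,
      S.dvec_apply h.ge]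
  · rw [S.P_dX_of_lt h, S.P_dX_of_lt (by omega), sub_self, if_neg]
    rintro rfl
    omega

theorem dual_ext {f g : StrongDual ℝ S.X} (h : ∀ γ, f (S.dX γ) = g (S.dX γ)) : f = g := by
  have key : ∀ x (hx : x ∈ S.X), f ⟨x, hx⟩ = g ⟨x, hx⟩ := by
    have h1 : ∀ x (hx : x ∈ Submodule.span ℝ (Set.range S.dvec)) (hx' : x ∈ S.X),
        f ⟨x, hx'⟩ = g ⟨x, hx'⟩ := by
      intro x hx
      have hle : ∀ y ∈ Submodule.span ℝ (Set.range S.dvec), y ∈ S.X := fun y hy =>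
        (Submodule.span ℝ (Set.range S.dvec)).le_topologicalClosure hy
      induction hx using Submodule.span_induction with
      | mem x hx => rintro hx'; obtain ⟨γ, rfl⟩ := hx; exact h γ
      | zero => intro hx'; exact (map_zero f).trans (map_zero g).symm
      | add x y hx hy ihx ihy =>
        intro hx'
        have e : (⟨x + y, hx'⟩ : S.X) = ⟨x, hle x hx⟩ + ⟨y, hle y hy⟩ := rfl
        rw [e, map_add, map_add, ihx, ihy]
      | smul a x hx ihx =>
        intro hx'
        have e : (⟨a • x, hx'⟩ : S.X) = a • ⟨x, hle x hx⟩ := rfl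
        rw [e, map_smul, map_smul, ihx]
    intro x hx
    have hcl : (⟨x, hx⟩ : S.X) ∈ closure
        {y : S.X | (y : Linfty Γ) ∈ Submodule.span ℝ (Set.range S.dvec)} := by
      rw [closure_subtype]
      refine closure_mono ?_ (show x ∈ closure
        (Submodule.span ℝ (Set.range S.dvec) : Set (Linfty Γ)) from hx)
      intro y hy
      exact ⟨⟨y, (Submodule.span ℝ (Set.range S.dvec)).le_topologicalClosure hy⟩, hy, rfl⟩
    have hclosed : IsClosed {y : S.X | f y = g y} := isClosed_eq f.continuous g.continuous
    exact hclosed.closure_subset_iff.2 (fun y hy => h1 y hy y.2) hcl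
  ext x
  exact key x x.2

/-- The expansion of `e_γ^*`. -/
theorem evalX_eq_sum {γ : Γ} {q : ℕ} (h : S.rank γ ≤ q) :
    S.evalX γ = ∑ η ∈ S.Gam q, S.dvec η γ • S.dstar η := by
  classical
  apply S.dual_ext
  intro ζ
  rw [evalX_dX, ContinuousLinearMap.sum_apply]
  simp only [ContinuousLinearMap.smul_apply, dstar_dX, smul_eq_mul, mul_ite, mul_one, mul_zero,
    Finset.sum_ite_eq']
  split_ifs with hz
  · rfl
  · rw [mem_Gam_iff] at hz
    rw [S.dvec_apply (by omega), if_neg]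
    rintro rfl
    omega

/-- The expansion of `c_γ^*`. -/
theorem cstar_eq_sum {γ : Γ} {q : ℕ} (h : S.rank γ = q + 1) :
    S.cstar γ = ∑ η ∈ S.Gam q, S.dvec η γ • S.dstar η := by
  classical
  apply S.dual_ext
  intro ζ
  rw [cstar, ContinuousLinearMap.sub_apply, evalX_dX, dstar_dX, ContinuousLinearMap.sum_apply]
  simp only [ContinuousLinearMap.smul_apply, dstar_dX, smul_eq_mul, mul_ite, mul_one, mul_zero,
    Finset.sum_ite_eq']
  by_cases hz : S.rank ζ ≤ q
  · rw [if_pos ((S.mem_Gam_iff _ _).2 hz), if_neg, sub_zero]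
    rintro rfl
    omega
  · rw [if_neg (fun h' => hz ((S.mem_Gam_iff _ _).1 h')), S.dvec_apply (by omega), sub_self]

theorem apply_eq_zero_of_span {A : Set (StrongDual ℝ S.X)} {x : S.X} (h : ∀ f ∈ A, f x = 0)
    {f : StrongDual ℝ S.X} (hf : f ∈ Submodule.span ℝ A) : f x = 0 := by
  induction hf using Submodule.span_induction with
  | mem f hf => exact h f hf
  | zero => rfl
  | add f g _ _ hf hg => rw [ContinuousLinearMap.add_apply, hf, hg, add_zero]
  | smul a f _ hf => rw [ContinuousLinearMap.smul_apply, hf, smul_zero]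

theorem cstar_dX_of_ne {γ η : Γ} (h : η ≠ γ) :
    S.cstar η (S.dX γ) = S.evalX η (S.dX γ) := by
  classical
  rw [cstar, ContinuousLinearMap.sub_apply, dstar_dX, if_neg h, sub_zero]

theorem d_of_a {Γ' : Set Γ}
    (h : ∀ γ ∈ Γ', S.dstar γ ∈ Submodule.span ℝ (S.evalX '' Γ')) :
    ∀ γ ∉ Γ', ∀ η ∈ Γ', S.evalX η (S.dX γ) = 0 := by
  classical
  intro γ hγ η
  induction hn : S.rank η using Nat.strong_induction_on generalizing η with
  | _ n ih =>
  intro hη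
  obtain ⟨a, ha, hsum⟩ := (Finsupp.mem_span_image_iff_linearCombination ℝ).1 (h η hη)
  rw [Finsupp.mem_supported] at ha
  have hev : ∀ ζ, S.dstar η (S.dX ζ) = ∑ ξ ∈ a.support, a ξ * S.dvec ζ ξ := by
    intro ζ
    rw [← hsum, Finsupp.linearCombination_apply, Finsupp.sum, ContinuousLinearMap.sum_apply]
    rfl
  -- no other coefficients of large rank
  have hB : ∀ ξ ∈ a.support, ξ ≠ η → S.rank ξ < S.rank η := by
    by_contra! hcon
    obtain ⟨ξ₀, h₀, h₁, h₂⟩ := hcon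
    let B := a.support.filter (fun ξ => ξ ≠ η ∧ S.rank η ≤ S.rank ξ)
    obtain ⟨ξ, hξB, hmax⟩ := B.exists_max_image S.rank
      ⟨ξ₀, Finset.mem_filter.2 ⟨h₀, h₁, h₂⟩⟩
    obtain ⟨hξ, hne, hle⟩ := Finset.mem_filter.1 hξB
    have e := hev ξ
    rw [dstar_dX, if_neg hne.symm, Finset.sum_eq_single ξ, S.dvec_apply le_rfl, if_pos rfl,
      mul_one] at e
    · exact (Finsupp.mem_support_iff.1 hξ) e.symm
    · intro ζ hζ hζξ
      have : S.rank ζ ≤ S.rank ξ := by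
        by_contra hlt
        have := hmax ζ (Finset.mem_filter.2 ⟨hζ, by rintro rfl; omega, by omega⟩)
        omega
      rw [S.dvec_apply this, if_neg hζξ, mul_zero]
    · exact fun h' => absurd hξ h'
  have hother : ∀ ξ ∈ a.support, ξ ≠ η → S.dvec γ ξ = 0 := fun ξ hξ hne =>
    ih _ (hn ▸ hB ξ hξ hne) ξ rfl (ha hξ)
  have h1 : a η = 1 := by
    have e := hev η
    rw [dstar_dX, if_pos rfl, Finset.sum_eq_single η, S.dvec_apply le_rfl, if_pos rfl,
      mul_one] at e
    · exact e.symm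
    · intro ξ hξ hne
      rw [S.dvec_apply (hB ξ hξ hne).le, if_neg hne, mul_zero]
    · intro h'
      rw [Finsupp.notMem_support_iff.1 h', zero_mul]
  have e := hev γ
  rw [dstar_dX, if_neg (fun h' : η = γ => hγ (h' ▸ hη)), Finset.sum_eq_single η, h1, one_mul] at e
  · exact e.symm
  · intro ξ hξ hne
    rw [hother ξ hξ hne, mul_zero]
  · intro h'
    rw [Finsupp.notMem_support_iff.1 h', zero_mul]

theorem b_of_d {Γ' : Set Γ} (h : ∀ γ ∉ Γ', ∀ η ∈ Γ', S.evalX η (S.dX γ) = 0) (q : ℕ) :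
    Submodule.span ℝ (S.dstar '' (Γ' ∩ (S.Gam q : Set Γ))) =
      Submodule.span ℝ (S.evalX '' (Γ' ∩ (S.Gam q : Set Γ))) := by
  classical
  apply le_antisymm
  · rw [Submodule.span_le]
    rintro _ ⟨γ, ⟨hγ, hγq⟩, rfl⟩
    have hr : S.rank γ ≤ q := (S.mem_Gam_iff _ _).1 hγq
    clear hγq
    induction hn : S.rank γ using Nat.strong_induction_on generalizing γ with
    | _ n ih =>
    have e : S.dstar γ = S.evalX γ - S.cstar γ := by rw [cstar, sub_sub_cancel]
    have hp := S.rank_pos γ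
    rw [e, S.cstar_eq_sum (q := S.rank γ - 1) (by omega)]
    refine Submodule.sub_mem _
      (Submodule.subset_span ⟨γ, ⟨hγ, (S.mem_Gam_iff _ _).2 hr⟩, rfl⟩) ?_
    refine Submodule.sum_mem _ fun η hη => ?_
    rw [mem_Gam_iff] at hη
    by_cases hη' : η ∈ Γ'
    · exact Submodule.smul_mem _ _ (ih (S.rank η) (by omega) η hη' (by omega) rfl)
    · rw [← S.evalX_dX, h η hη' γ hγ, zero_smul]
      exact Submodule.zero_mem _
  · rw [Submodule.span_le]
    rintro _ ⟨γ, ⟨hγ, hγq⟩, rfl⟩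
    rw [S.evalX_eq_sum ((S.mem_Gam_iff _ _).1 hγq)]
    refine Submodule.sum_mem _ fun η hη => ?_
    by_cases hη' : η ∈ Γ'
    · exact Submodule.smul_mem _ _ (Submodule.subset_span ⟨η, ⟨hη', hη⟩, rfl⟩)
    · rw [← S.evalX_dX, h η hη' γ hγ, zero_smul]
      exact Submodule.zero_mem _

theorem PE_dX (p : ℕ) (r : ℕ∞) (γ : Γ) :
    S.PE p r (S.dX γ) = 0 ∨ S.PE p r (S.dX γ) = S.dvec γ ∨
      S.PE p r (S.dX γ) = - S.dvec γ := by
  have hP : ∀ q, S.P q (S.dX γ) = 0 ∨ S.P q (S.dX γ) = S.dvec γ := fun q => by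
    rcases le_or_gt (S.rank γ) q with h | h
    · exact Or.inr (S.P_dX_of_le h)
    · exact Or.inl (S.P_dX_of_lt h)
  induction r using ENat.recTopCoe with
  | top =>
    have e : ((S.dX γ : S.X) : Linfty Γ) = S.dvec γ := rfl
    rw [PE_top_apply, e]
    rcases hP p with h | h <;> rw [h] <;> simp
  | coe r =>
    rw [PE_coe_apply]
    rcases hP p with h | h <;> rcases hP r with h' | h' <;> rw [h, h'] <;> simp

end BDSystem

/-- Characterizations of self-determined subsets: for an infinite subset
`Γ'` of `Γ`, with `Γ'_q = Γ' ∩ Γ_q` and `q₀ = min {q : Γ'_q ≠ ∅}`, the following are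
equivalent: (a) `Γ'` is self-determined; (b) for all `q ≥ q₀`,
`span {d_γ^* : γ ∈ Γ'_q} = span {e_γ^* : γ ∈ Γ'_q}`; (c) the spans coincide at `q₀` and for
all `q ≥ q₀` and `γ ∈ Γ' ∩ Δ_{q+1}`, `c_γ^*` lies in the span of
`{e_η^* ∘ P_E : η ∈ Γ'_q, E an interval of ℕ}`; (d) `e_η^*(d_γ) = 0` for all `γ ∉ Γ'`,
`η ∈ Γ'`; (e) `c_η^*(d_γ) = 0` for all `γ ∉ Γ'`, `η ∈ Γ'`. -/
theorem selfDetermined_tfae {Γ : Type} (S : BDSystem Γ) (Γ' : Set Γ) (hinf : Γ'.Infinite)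
    (q₀ : ℕ) (hq₀ : IsLeast {q : ℕ | (Γ' ∩ (S.Gam q : Set Γ)).Nonempty} q₀) :
    List.TFAE [
      S.SelfDetermined Γ',
      ∀ q, q₀ ≤ q →
        Submodule.span ℝ (S.dstar '' (Γ' ∩ (S.Gam q : Set Γ))) =
          Submodule.span ℝ (S.evalX '' (Γ' ∩ (S.Gam q : Set Γ))),
      (Submodule.span ℝ (S.dstar '' (Γ' ∩ (S.Gam q₀ : Set Γ))) =
          Submodule.span ℝ (S.evalX '' (Γ' ∩ (S.Gam q₀ : Set Γ)))) ∧
        (∀ q, q₀ ≤ q → ∀ γ ∈ Γ', S.rank γ = q + 1 →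
          S.cstar γ ∈ Submodule.span ℝ
            {f : StrongDual ℝ ↥S.X |
              ∃ η ∈ Γ' ∩ (S.Gam q : Set Γ), ∃ (p : ℕ) (r : ℕ∞), (p : ℕ∞) < r ∧
                f = (evalLinfty η).comp (S.PE p r)}),
      ∀ γ ∉ Γ', ∀ η ∈ Γ', S.evalX η (S.dX γ) = 0,
      ∀ γ ∉ Γ', ∀ η ∈ Γ', S.cstar η (S.dX γ) = 0 ] := by
  classical
  tfae_have 1 → 4 := fun h => S.d_of_a h.2
  tfae_have 4 → 2 := fun h q _ => S.b_of_d h q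
  tfae_have 2 → 1 := by
    intro h
    refine ⟨hinf, fun γ hγ => ?_⟩
    have h1 : S.dstar γ ∈ Submodule.span ℝ
        (S.dstar '' (Γ' ∩ (S.Gam (max q₀ (S.rank γ)) : Set Γ))) :=
      Submodule.subset_span ⟨γ, ⟨hγ, (S.mem_Gam_iff _ _).2 (le_max_right _ _)⟩, rfl⟩
    rw [h _ (le_max_left _ _)] at h1
    exact Submodule.span_mono (Set.image_mono Set.inter_subset_left) h1
  tfae_have 4 → 3 := by
    intro h
    refine ⟨S.b_of_d h q₀, fun q _ γ hγ hr => ?_⟩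
    rw [S.cstar_eq_sum hr]
    refine Submodule.sum_mem _ fun η hη => ?_
    by_cases hη' : η ∈ Γ'
    · refine Submodule.smul_mem _ _ (Submodule.subset_span
        ⟨η, ⟨hη', hη⟩, S.rank η - 1, (S.rank η : ℕ∞), ?_, rfl⟩)
      have := S.rank_pos η
      exact_mod_cast (by omega : S.rank η - 1 < S.rank η)
    · rw [← S.evalX_dX, h η hη' γ hγ, zero_smul]
      exact Submodule.zero_mem _
  tfae_have 3 → 4 := by
    rintro ⟨h1, h2⟩ γ hγ η
    induction hn : S.rank η using Nat.strong_induction_on generalizing η with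
    | _ n ih =>
    intro hη
    have hge : q₀ ≤ S.rank η := hq₀.2 ⟨η, hη, S.mem_Gam_rank η⟩
    rcases hge.eq_or_lt with he | hlt
    · have hm : S.evalX η ∈ Submodule.span ℝ (S.evalX '' (Γ' ∩ (S.Gam q₀ : Set Γ))) :=
        Submodule.subset_span ⟨η, ⟨hη, (S.mem_Gam_iff _ _).2 he.ge⟩, rfl⟩
      rw [← h1] at hm
      refine S.apply_eq_zero_of_span ?_ hm
      rintro _ ⟨ζ, ⟨hζ, _⟩, rfl⟩
      rw [S.dstar_dX, if_neg (fun h' : ζ = γ => hγ (h' ▸ hζ))]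
    · have hm := h2 (S.rank η - 1) (by omega) η hη (by omega)
      rw [← S.cstar_dX_of_ne (fun h' : η = γ => hγ (h' ▸ hη))]
      refine S.apply_eq_zero_of_span ?_ hm
      rintro _ ⟨ζ, ⟨hζ, hζq⟩, p, r, _, rfl⟩
      have hζr : S.rank ζ ≤ S.rank η - 1 := (S.mem_Gam_iff _ _).1 hζq
      have h0 : evalLinfty ζ (S.dvec γ) = 0 := ih _ (by omega) ζ rfl hζ
      rw [ContinuousLinearMap.comp_apply]
      rcases S.PE_dX p r γ with h | h | h <;> rw [h]
      · exact map_zero _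
      · exact h0
      · rw [map_neg, h0, neg_zero]
  tfae_have 4 ↔ 5 := by
    refine forall₂_congr fun γ hγ => forall₂_congr fun η hη => ?_
    rw [S.cstar_dX_of_ne (fun h' : η = γ => hγ (h' ▸ hη))]
  tfae_finish
end
end

section
/- Let (Γ_q, i_q) be a Bourgain–Delbaen system on Γ with constant C, with associated Bourgain–Delbaen space X, and let Γ' be a self-determined subset of Γ. For each q set Γ''_q = Γ_q ∖ Γ', and identify ℓ∞(Γ''_q) with the subspace of ℓ∞(Γ_q) of functions vanishing on Γ' ∩ Γ_q. Then for every q, i_q[ℓ∞(Γ''_q)] equals the linear span of {d_γ : γ ∈ Γ''_q}; moreover ‖x‖_∞ ≤ ‖i_q(x)‖_∞ ≤ C‖x‖_∞ for every x ∈ ℓ∞(Γ''_q), the subspaces i_q[ℓ∞(Γ''_q)] increase with q, and their union is dense in Y := the closed linear span of {d_γ : γ ∈ Γ ∖ Γ'}. In particular Y is an L∞-space: it is the closure of an increasing union of finite-dimensional subspaces each of which is C-isomorphic to ℓ∞^n of the corresponding dimension n. -/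
noncomputable section
open scoped ENNReal

/-- A Banach space is an `L∞,C`-space if it is the closure of an increasing union of
finite-dimensional subspaces, each `C`-isomorphic to `ℓ∞^n` of the corresponding dimension. -/
def IsLinftySpaceWith (C : ℝ) (X : Type*) [NormedAddCommGroup X] [NormedSpace ℝ X] : Prop :=
  ∃ F : ℕ → Submodule ℝ X, Monotone F ∧ (∀ n, FiniteDimensional ℝ ↥(F n)) ∧
    Dense (⋃ n, (F n : Set X)) ∧
    ∀ n, ∃ T : ↥(F n) ≃L[ℝ] (Fin (Module.finrank ℝ ↥(F n)) → ℝ),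
      ‖(T : ↥(F n) →L[ℝ] (Fin (Module.finrank ℝ ↥(F n)) → ℝ))‖ *
        ‖(T.symm : (Fin (Module.finrank ℝ ↥(F n)) → ℝ) →L[ℝ] ↥(F n))‖ ≤ C

namespace BDSystem

variable {Γ : Type} (S : BDSystem Γ)

theorem rank_le {γ : Γ} {q : ℕ} (h : γ ∈ S.Gam q) : S.rank γ ≤ q := by
  unfold rank
  exact @Nat.find_min' _ (Classical.decPred _) (S.exhaustive γ) _ h

theorem mem_Gam_of_rank_le {γ : Γ} {q : ℕ} (h : S.rank γ ≤ q) : γ ∈ S.Gam q :=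
  S.mono.monotone h (S.mem_Gam_rank γ)

theorem i_eq_of_le {p q : ℕ} (h : p ≤ q) (x : ↥(S.Gam p) → ℝ) :
    S.i p x = S.i q (fun γ : ↥(S.Gam q) => (S.i p x) (γ : Γ)) := by
  rcases h.eq_or_lt with rfl | h
  · congr 1
    funext γ
    exact (S.isExtension _ x γ).symm
  · exact S.compatible p q h x

/-- The functions on `Γ_q` vanishing on `A`. -/
def van (A : Set Γ) (q : ℕ) : Submodule ℝ (↥(S.Gam q) → ℝ) where
  carrier := {x | ∀ η : ↥(S.Gam q), (η : Γ) ∈ A → x η = 0}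
  add_mem' := fun {a b} ha hb η h => by simp [ha η h, hb η h]
  zero_mem' := fun η _ => rfl
  smul_mem' := fun c x hx η h => by simp [hx η h]

/-- The extension operators preserve vanishing on `A`. -/
def Pres (A : Set Γ) : Prop :=
  ∀ p, ∀ x ∈ S.van A p, ∀ η ∈ A, (S.i p x) η = 0

theorem mono_of_pres {A : Set Γ} (hA : S.Pres A) {p q : ℕ} (h : p ≤ q) :
    (S.van A p).map (S.i p : (↥(S.Gam p) → ℝ) →ₗ[ℝ] Linfty Γ) ≤
      (S.van A q).map (S.i q : (↥(S.Gam q) → ℝ) →ₗ[ℝ] Linfty Γ) := by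
  rintro _ ⟨x, hx, rfl⟩
  refine ⟨fun γ : ↥(S.Gam q) => (S.i p x) (γ : Γ), ?_, (S.i_eq_of_le h x).symm⟩
  intro η hη
  exact hA p x hx η hη

theorem span_le_of_pres {A : Set Γ} (hA : S.Pres A) (q : ℕ) :
    Submodule.span ℝ (S.dvec '' ((S.Gam q : Set Γ) \ A)) ≤
      (S.van A q).map (S.i q : (↥(S.Gam q) → ℝ) →ₗ[ℝ] Linfty Γ) := by
  rw [Submodule.span_le]
  rintro _ ⟨γ, ⟨hγ, hγA⟩, rfl⟩
  apply S.mono_of_pres hA (S.rank_le hγ)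
  refine ⟨_, ?_, rfl⟩
  intro η hη
  have : (η : Γ) ≠ γ := fun h => hγA (h ▸ hη)
  simp [this]

theorem le_span_of_pres {A : Set Γ} (hA : S.Pres A) (q : ℕ) :
    ∀ x ∈ S.van A q, S.i q x ∈ Submodule.span ℝ (S.dvec '' ((S.Gam q : Set Γ) \ A)) := by
  classical
  induction q with
  | zero =>
    intro x _
    have : x = 0 := by
      funext η
      exact absurd (S.rank_le η.2) (by have := S.rank_pos (η : Γ); omega)
    rw [this, map_zero]
    exact Submodule.zero_mem _
  | succ q ih =>
    intro x hx
    have hsub : S.Gam q ⊆ S.Gam (q+1) := S.mono.monotone (Nat.le_succ q)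
    set x0 : ↥(S.Gam q) → ℝ := fun η => x ⟨η, hsub η.2⟩ with hx0
    have hx0v : x0 ∈ S.van A q := fun η hη => hx _ hη
    have h1 := ih x0 hx0v
    have h1' : S.i q x0 ∈ Submodule.span ℝ (S.dvec '' ((S.Gam (q+1) : Set Γ) \ A)) := by
      refine Submodule.span_mono ?_ h1
      apply Set.image_mono
      exact Set.sdiff_subset_sdiff_left (by exact_mod_cast hsub)
    set w : ↥(S.Gam (q+1)) → ℝ :=
      x - (fun η : ↥(S.Gam (q+1)) => (S.i q x0) (η : Γ)) with hw
    have hwA : ∀ η : ↥(S.Gam (q+1)), (η : Γ) ∈ A → w η = 0 := by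
      intro η hη
      simp [hw, hx η hη, hA q x0 hx0v η hη]
    have hwq : ∀ η : ↥(S.Gam (q+1)), (η : Γ) ∈ S.Gam q → w η = 0 := by
      intro η hη
      have := S.isExtension q x0 ⟨η, hη⟩
      simp only at this
      change x η - (S.i q x0) (η : Γ) = 0
      rw [this]
      exact sub_self _
    have hx_eq : S.i (q+1) x = S.i q x0 + S.i (q+1) w := by
      rw [hw, map_sub, ← S.i_eq_of_le (Nat.le_succ q) x0]
      abel
    rw [hx_eq]
    refine Submodule.add_mem _ h1' ?_
    have hsum : w = ∑ η, w η • (Pi.single η (1:ℝ) : ↥(S.Gam (q+1)) → ℝ) :=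
      pi_eq_sum_univ' w |>.trans (by
        refine Finset.sum_congr rfl fun η _ => ?_
        congr 1)
    rw [hsum, map_sum]
    refine Submodule.sum_mem _ fun η _ => ?_
    rw [map_smul]
    by_cases hη0 : w η = 0
    · rw [hη0, zero_smul]; exact Submodule.zero_mem _
    refine Submodule.smul_mem _ _ (Submodule.subset_span ⟨η, ⟨η.2, fun h => hη0 (hwA η h)⟩, ?_⟩)
    have hr : S.rank (η : Γ) = q + 1 := by
      apply le_antisymm (S.rank_le η.2)
      by_contra hlt
      exact hη0 (hwq η (S.mem_Gam_of_rank_le (by omega)))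
    have key : ∀ r (hr : r = q + 1), S.i r (fun ξ => @ite _ ((ξ : Γ) = η) (Classical.dec _) 1 0)
        = S.i (q+1) (Pi.single η (1:ℝ)) := by
      rintro r rfl
      congr 1
      funext ξ
      by_cases h : ξ = η
      · subst h; simp
      · have h' : (ξ : Γ) ≠ η := fun h2 => h (Subtype.ext h2)
        rw [Pi.single_eq_of_ne h, if_neg h']
    exact key _ hr

theorem pres_empty : S.Pres ∅ := fun _ _ _ _ h => absurd h (Set.notMem_empty _)

theorem i_mem_X_s3 (q : ℕ) (x : ↥(S.Gam q) → ℝ) : S.i q x ∈ S.X := by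
  have h := S.le_span_of_pres S.pres_empty q x (fun η h => absurd h (Set.notMem_empty _))
  refine Submodule.le_topologicalClosure _ (Submodule.span_mono ?_ h)
  exact Set.image_subset_range _ _

theorem exists_bound_span {A : Set Γ} (f : StrongDual ℝ ↥S.X)
    (hf : f ∈ Submodule.span ℝ (S.evalX '' A)) :
    ∃ N, ∀ M, N ≤ M → ∀ z : ↥S.X, (∀ η ∈ A, η ∈ S.Gam M → (z : Linfty Γ) η = 0) → f z = 0 := by
  induction hf using Submodule.span_induction with
  | mem f h =>
    obtain ⟨η, hη, rfl⟩ := h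
    exact ⟨S.rank η, fun M hM z hz => hz η hη (S.mem_Gam_of_rank_le hM)⟩
  | zero => exact ⟨0, fun _ _ _ _ => rfl⟩
  | add f g _ _ hf hg =>
    obtain ⟨N1, h1⟩ := hf
    obtain ⟨N2, h2⟩ := hg
    refine ⟨max N1 N2, fun M hM z hz => ?_⟩
    simp [h1 M (le_trans (le_max_left _ _) hM) z hz, h2 M (le_trans (le_max_right _ _) hM) z hz]
  | smul c f _ hf =>
    obtain ⟨N1, h1⟩ := hf
    refine ⟨N1, fun M hM z hz => ?_⟩
    simp [h1 M hM z hz]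

theorem dstar_apply (η : Γ) (z : ↥S.X) :
    S.dstar η z = (z : Linfty Γ) η -
      (S.i (S.rank η - 1) (fun ξ => (z : Linfty Γ) (ξ : Γ))) η := by
  have h : (S.i (S.rank η) (fun ξ => (z : Linfty Γ) (ξ : Γ))) η = (z : Linfty Γ) η :=
    S.isExtension (S.rank η) (fun ξ => (z : Linfty Γ) (ξ : Γ)) ⟨η, S.mem_Gam_rank η⟩
  rw [← h]
  rfl

theorem step {A : Set Γ} (hsd : S.SelfDetermined A) {η : Γ} (hη : η ∈ A)
    (x : ↥(S.Gam (S.rank η - 1)) → ℝ) (hx : x ∈ S.van A (S.rank η - 1)) :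
    (S.i (S.rank η - 1) x) η = 0 := by
  classical
  obtain ⟨N, hN⟩ := S.exists_bound_span _ (hsd.2 η hη)
  set M := max N (S.rank η) with hM
  set x' : ↥(S.Gam M) → ℝ := fun ξ =>
    if h : (ξ : Γ) ∈ S.Gam (S.rank η - 1) then x ⟨ξ, h⟩ else 0 with hx'
  have hz := hN M (le_max_left _ _) ⟨S.i M x', S.i_mem_X_s3 M x'⟩ (by
    intro ξ hξA hξ
    have := S.isExtension M x' ⟨ξ, hξ⟩
    simp only at this
    change (S.i M x') ξ = 0
    rw [this]
    simp only [hx']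
    split_ifs with h
    · exact hx _ hξA
    · rfl)
  rw [dstar_apply] at hz
  have hηM : η ∈ S.Gam M := S.mem_Gam_of_rank_le (le_max_right _ _)
  have e1 : (S.i M x') η = 0 := by
    have := S.isExtension M x' ⟨η, hηM⟩
    simp only at this
    rw [this, hx']
    simp only
    rw [dif_neg]
    intro h
    have := S.rank_le h
    have := S.rank_pos η
    omega
  have e2 : (fun ξ : ↥(S.Gam (S.rank η - 1)) => (S.i M x') (ξ : Γ)) = x := by
    funext ξ
    have hs : (ξ : Γ) ∈ S.Gam M :=
      S.mono.monotone ((Nat.sub_le _ _).trans (le_max_right _ _)) ξ.2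
    have := S.isExtension M x' ⟨ξ, hs⟩
    simp only at this
    rw [this, hx']
    simp
  simp only [e1, e2] at hz
  linarith

theorem pres_of_selfDetermined {A : Set Γ} (hsd : S.SelfDetermined A) : S.Pres A := by
  intro p x hx
  have : ∀ n, ∀ η ∈ A, S.rank η = n → (S.i p x) η = 0 := by
    intro n
    induction n using Nat.strong_induction_on with
    | _ n ih =>
      intro η hη hn
      by_cases hp : S.rank η ≤ p
      · have := S.isExtension p x ⟨η, S.mem_Gam_of_rank_le hp⟩
        simp only at this
        rw [this]
        exact hx _ hη
      · rw [S.i_eq_of_le (p := p) (q := S.rank η - 1) (by omega) x]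
        apply S.step hsd hη
        intro ξ hξ
        have h1 := S.rank_le ξ.2
        have h2 := S.rank_pos η
        exact ih _ (by omega) ξ hξ rfl
  exact fun η hη => this _ η hη rfl

theorem norm_le_norm_i (q : ℕ) (x : ↥(S.Gam q) → ℝ) : ‖x‖ ≤ ‖S.i q x‖ := by
  refine (pi_norm_le_iff_of_nonneg (norm_nonneg _)).mpr fun γ => ?_
  rw [← S.isExtension q x γ]
  exact lp.norm_apply_le_norm ENNReal.top_ne_zero _ _

theorem norm_i_le_const (q : ℕ) : ‖S.i q‖ ≤ S.const :=
  le_ciSup (f := fun q => ‖S.i q‖) ⟨S.normBound, by rintro _ ⟨q, rfl⟩; exact S.norm_i_le q⟩ q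

theorem const_nonneg : 0 ≤ S.const := (norm_nonneg _).trans (S.norm_i_le_const 0)

theorem norm_i_apply_le (q : ℕ) (x : ↥(S.Gam q) → ℝ) : ‖S.i q x‖ ≤ S.const * ‖x‖ :=
  ((S.i q).le_opNorm x).trans (mul_le_mul_of_nonneg_right (S.norm_i_le_const q) (norm_nonneg _))

/-- Abstract construction of the isomorphism with `ℓ∞^n`. -/
theorem exists_iso {A : Set Γ} {E : Type*} [NormedAddCommGroup E] [NormedSpace ℝ E] (q : ℕ)
    (j : E →ₗ[ℝ] Linfty Γ) (hj : ∀ y, ‖j y‖ = ‖y‖)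
    (hmem : ∀ y, j y ∈ (S.van A q).map (S.i q : (↥(S.Gam q) → ℝ) →ₗ[ℝ] Linfty Γ))
    (hsurj : ∀ x ∈ S.van A q, ∃ y, j y = S.i q x) :
    FiniteDimensional ℝ E ∧ ∃ T : E ≃L[ℝ] (Fin (Module.finrank ℝ E) → ℝ),
      ‖(T : E →L[ℝ] (Fin (Module.finrank ℝ E) → ℝ))‖ *
        ‖(T.symm : (Fin (Module.finrank ℝ E) → ℝ) →L[ℝ] E)‖ ≤ S.const := by
  classical
  let I := {η : ↥(S.Gam q) // (η : Γ) ∉ A}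
  let R : E →ₗ[ℝ] (I → ℝ) :=
    { toFun := fun y η => (j y) (η.1 : Γ)
      map_add' := fun f g => by funext γ; simp [lp.coeFn_add]
      map_smul' := fun c f => by funext γ; simp [lp.coeFn_smul] }
  have hRle : ∀ y, ‖R y‖ ≤ ‖y‖ := by
    intro y
    refine (pi_norm_le_iff_of_nonneg (norm_nonneg _)).mpr fun γ => ?_
    rw [← hj]
    exact lp.norm_apply_le_norm ENNReal.top_ne_zero _ _
  have hRge : ∀ y, ‖y‖ ≤ S.const * ‖R y‖ := by
    intro y
    obtain ⟨x, hx, hxy⟩ := hmem y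
    have hxy' : S.i q x = j y := hxy
    rw [← hj, ← hxy']
    refine (S.norm_i_apply_le q x).trans (mul_le_mul_of_nonneg_left ?_ S.const_nonneg)
    refine (pi_norm_le_iff_of_nonneg (norm_nonneg _)).mpr fun γ => ?_
    by_cases h : (γ : Γ) ∈ A
    · rw [hx γ h, norm_zero]; exact norm_nonneg _
    · have : R y ⟨γ, h⟩ = x γ := by
        change (j y) (γ : Γ) = x γ
        rw [← hxy', S.isExtension]
      rw [← this]
      exact norm_le_pi_norm _ _
  have hbij : Function.Bijective R := by
    constructor
    · rw [injective_iff_map_eq_zero]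
      intro y hy
      have := hRge y
      rw [hy, norm_zero, mul_zero] at this
      exact norm_le_zero_iff.mp this
    · intro v
      let x : ↥(S.Gam q) → ℝ := fun η => if h : (η : Γ) ∈ A then 0 else v ⟨η, h⟩
      obtain ⟨y, hy⟩ := hsurj x (fun η h => by simp [x, h])
      refine ⟨y, ?_⟩
      funext η
      change (j y) (η.1 : Γ) = v η
      rw [hy, S.isExtension]
      simp [x, η.2]
  let L : E ≃ₗ[ℝ] (I → ℝ) := LinearEquiv.ofBijective R hbij
  have hfd : FiniteDimensional ℝ E := L.symm.finiteDimensional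
  refine ⟨hfd, ?_⟩
  have hcard : Module.finrank ℝ E = Fintype.card I := by
    rw [L.finrank_eq, Module.finrank_fintype_fun_eq_card]
  let e : Fin (Module.finrank ℝ E) ≃ I := (finCongr hcard).trans (Fintype.equivFin I).symm
  let L2 := L.trans (LinearEquiv.funCongrLeft ℝ ℝ e)
  have hn : ∀ y, ‖L2 y‖ = ‖R y‖ := by
    intro y
    apply le_antisymm
    · refine (pi_norm_le_iff_of_nonneg (norm_nonneg _)).mpr fun k => ?_
      exact norm_le_pi_norm (R y) (e k)
    · refine (pi_norm_le_iff_of_nonneg (norm_nonneg _)).mpr fun k => ?_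
      have := norm_le_pi_norm (L2 y) (e.symm k)
      have h2 : L2 y (e.symm k) = R y k := by
        change R y (e (e.symm k)) = R y k
        rw [e.apply_symm_apply]
      rwa [h2] at this
  refine ⟨L2.toContinuousLinearEquiv, ?_⟩
  rw [← one_mul S.const]
  refine mul_le_mul ?_ ?_ (norm_nonneg _) zero_le_one
  · refine ContinuousLinearMap.opNorm_le_bound _ zero_le_one fun y => ?_
    rw [one_mul]
    exact (hn y).le.trans (hRle y)
  · refine ContinuousLinearMap.opNorm_le_bound _ S.const_nonneg fun v => ?_
    obtain ⟨y, rfl⟩ := L2.surjective v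
    have : L2.toContinuousLinearEquiv.symm (L2 y) = y := L2.symm_apply_apply y
    change ‖L2.toContinuousLinearEquiv.symm (L2 y)‖ ≤ _
    rw [this, hn]
    exact hRge y

end BDSystem

theorem BDSystem.exists_iso_sub {Γ : Type} (S : BDSystem Γ) {A : Set Γ} {Y : Type*}
    [NormedAddCommGroup Y] [NormedSpace ℝ Y] (q : ℕ)
    (j : Y →ₗ[ℝ] Linfty Γ) (hj : ∀ y, ‖j y‖ = ‖y‖) (F : Submodule ℝ Y)
    (hmem : ∀ y ∈ F, j y ∈ (S.van A q).map (S.i q : (↥(S.Gam q) → ℝ) →ₗ[ℝ] Linfty Γ))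
    (hsurj : ∀ x ∈ S.van A q, ∃ y ∈ F, j y = S.i q x) :
    FiniteDimensional ℝ ↥F ∧ ∃ T : ↥F ≃L[ℝ] (Fin (Module.finrank ℝ ↥F) → ℝ),
      ‖(T : ↥F →L[ℝ] (Fin (Module.finrank ℝ ↥F) → ℝ))‖ *
        ‖(T.symm : (Fin (Module.finrank ℝ ↥F) → ℝ) →L[ℝ] ↥F)‖ ≤ S.const := by
  refine S.exists_iso (A := A) q (j.comp F.subtype) (fun y => hj y) (fun y => hmem y y.2) ?_
  intro x hx
  obtain ⟨y, hy, h⟩ := hsurj x hx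
  exact ⟨⟨y, hy⟩, h⟩

/-- If `Γ'` is a self-determined subset of `Γ` then, identifying
`ℓ∞(Γ''_q)` (`Γ''_q = Γ_q ∖ Γ'`) with the functions on `Γ_q` vanishing on `Γ'`:
`i_q[ℓ∞(Γ''_q)] = span {d_γ : γ ∈ Γ''_q}`; each `i_q` is a `C`-isomorphism on this subspace;
these subspaces increase with `q`; their union is dense in
`Y = closed span {d_γ : γ ∈ Γ ∖ Γ'}`; and in particular `Y` is an `L∞`-space with
constant `C = sup_q ‖i_q‖`. -/
theorem selfDetermined_complement_is_Linfty {Γ : Type} (S : BDSystem Γ) (Γ' : Set Γ)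
    (hsd : S.SelfDetermined Γ') :
    (∀ q : ℕ, S.i q '' {x : ↥(S.Gam q) → ℝ | ∀ η : ↥(S.Gam q), (η : Γ) ∈ Γ' → x η = 0} =
      (Submodule.span ℝ (S.dvec '' ((S.Gam q : Set Γ) \ Γ')) : Set (Linfty Γ))) ∧
    (∀ q : ℕ, ∀ x : ↥(S.Gam q) → ℝ, (∀ η : ↥(S.Gam q), (η : Γ) ∈ Γ' → x η = 0) →
      ‖x‖ ≤ ‖S.i q x‖ ∧ ‖S.i q x‖ ≤ S.const * ‖x‖) ∧
    (∀ p q : ℕ, p ≤ q →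
      S.i p '' {x : ↥(S.Gam p) → ℝ | ∀ η : ↥(S.Gam p), (η : Γ) ∈ Γ' → x η = 0} ⊆
        S.i q '' {x : ↥(S.Gam q) → ℝ | ∀ η : ↥(S.Gam q), (η : Γ) ∈ Γ' → x η = 0}) ∧
    (closure (⋃ q : ℕ, S.i q '' {x : ↥(S.Gam q) → ℝ | ∀ η : ↥(S.Gam q), (η : Γ) ∈ Γ' → x η = 0}) =
      ((Submodule.span ℝ (S.dvec '' {γ : Γ | γ ∉ Γ'})).topologicalClosure : Set (Linfty Γ))) ∧
    IsLinftySpaceWith S.const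
      ↥((Submodule.span ℝ (S.dvec '' {γ : Γ | γ ∉ Γ'})).topologicalClosure) := by
  have hA := S.pres_of_selfDetermined hsd
  have h1 : ∀ q : ℕ, (S.van Γ' q).map (S.i q : (↥(S.Gam q) → ℝ) →ₗ[ℝ] Linfty Γ) =
      Submodule.span ℝ (S.dvec '' ((S.Gam q : Set Γ) \ Γ')) := by
    intro q
    apply le_antisymm
    · rintro _ ⟨x, hx, rfl⟩
      exact S.le_span_of_pres hA q x hx
    · exact S.span_le_of_pres hA q
  have hset : ∀ q : ℕ,
      S.i q '' {x : ↥(S.Gam q) → ℝ | ∀ η : ↥(S.Gam q), (η : Γ) ∈ Γ' → x η = 0} =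
      (((S.van Γ' q).map (S.i q : (↥(S.Gam q) → ℝ) →ₗ[ℝ] Linfty Γ) : Submodule ℝ (Linfty Γ)) :
        Set (Linfty Γ)) := fun q => rfl
  simp only [hset]
  have hmono : Monotone fun q : ℕ =>
      (S.van Γ' q).map (S.i q : (↥(S.Gam q) → ℝ) →ₗ[ℝ] Linfty Γ) :=
    fun p q h => S.mono_of_pres hA h
  have hunion : (⋃ q : ℕ, (((S.van Γ' q).map
      (S.i q : (↥(S.Gam q) → ℝ) →ₗ[ℝ] Linfty Γ) : Submodule ℝ (Linfty Γ)) : Set (Linfty Γ))) =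
      (Submodule.span ℝ (S.dvec '' {γ : Γ | γ ∉ Γ'}) : Set (Linfty Γ)) := by
    rw [← Submodule.coe_iSup_of_directed _ hmono.directed_le]
    congr 1
    apply le_antisymm
    · refine iSup_le fun q => ?_
      rw [h1]
      exact Submodule.span_mono (Set.image_mono fun γ h => h.2)
    · rw [Submodule.span_le]
      rintro _ ⟨γ, hγ, rfl⟩
      refine Submodule.mem_iSup_of_mem (S.rank γ) ?_
      rw [h1]
      exact Submodule.subset_span ⟨γ, ⟨S.mem_Gam_rank γ, hγ⟩, rfl⟩
  have hclos : closure (⋃ q : ℕ, (((S.van Γ' q).map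
      (S.i q : (↥(S.Gam q) → ℝ) →ₗ[ℝ] Linfty Γ) : Submodule ℝ (Linfty Γ)) : Set (Linfty Γ))) =
      ((Submodule.span ℝ (S.dvec '' {γ : Γ | γ ∉ Γ'})).topologicalClosure : Set (Linfty Γ)) := by
    rw [hunion, Submodule.topologicalClosure_coe]
  refine ⟨fun q => by rw [h1], fun q x _ => ⟨S.norm_le_norm_i q x, S.norm_i_apply_le q x⟩,
    fun p q h => S.mono_of_pres hA h, hclos, ?_⟩
  set Y := (Submodule.span ℝ (S.dvec '' {γ : Γ | γ ∉ Γ'})).topologicalClosure with hY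
  have hVY : ∀ q : ℕ, (S.van Γ' q).map (S.i q : (↥(S.Gam q) → ℝ) →ₗ[ℝ] Linfty Γ) ≤ Y := by
    intro q z hz
    have : z ∈ (Y : Set (Linfty Γ)) := by
      rw [← hclos]
      exact subset_closure (Set.mem_iUnion.mpr ⟨q, hz⟩)
    exact this
  let F : ℕ → Submodule ℝ ↥Y := fun q =>
    ((S.van Γ' q).map (S.i q : (↥(S.Gam q) → ℝ) →ₗ[ℝ] Linfty Γ)).comap Y.subtype
  have hiso := fun q => S.exists_iso_sub (A := Γ') q Y.subtype (fun y => rfl) (F q)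
    (fun y hy => hy) (fun x hx => ⟨⟨S.i q x, hVY q ⟨x, hx, rfl⟩⟩, ⟨x, hx, rfl⟩, rfl⟩)
  refine ⟨F, fun p q h => Submodule.comap_mono (hmono h), fun q => (hiso q).1, ?_,
    fun q => (hiso q).2⟩
  intro y
  rw [closure_subtype]
  have hy : (y : Linfty Γ) ∈ (Y : Set (Linfty Γ)) := y.2
  rw [← hclos] at hy
  refine closure_mono ?_ hy
  intro z hz
  obtain ⟨q, hq⟩ := Set.mem_iUnion.mp hz
  exact ⟨⟨z, hVY q hq⟩, Set.mem_iUnion.mpr ⟨q, hq⟩, rfl⟩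
end
end
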